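/- Let ρ > 0. If g : (0,∞) → ℂ is twice differentiable, satisfies g''(r) = i ρ^2 g(r) for all r > 0, and is square integrable on (0,∞), then there is a complex constant c such that g(r) = c · exp(e^{-i 3π/4} ρ r) for all r > 0. In particular, the space of square-integrable solutions of this equation is one-dimensional. -/

import Mathlib

open Set MeasureTheory

/-- Solutions of `f' = -w f` on `(0,∞)` are multiples of `r ↦ exp (-w r)`. -/
lemma exists_mul_exp_eq_of_hasDerivAt {f : ℝ → ℂ} {w : ℂ}
    (hf : ∀ r ∈ Ioi (0 : ℝ), HasDerivAt f (-w * f r) r) :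
    ∃ K : ℂ, ∀ r ∈ Ioi (0 : ℝ), f r = K * Complex.exp (-(w * r)) := by
  have hd : ∀ r ∈ Ioi (0 : ℝ), HasDerivAt (fun r : ℝ => f r * Complex.exp (w * r)) 0 r := by
    intro r hr
    have h : HasDerivAt (fun r : ℝ => w * (r : ℂ)) (w * 1) r :=
      (Complex.ofRealCLM.hasDerivAt (x := r)).const_mul w
    exact ((hf r hr).mul h.cexp).congr_deriv (by ring)
  obtain ⟨K, hK⟩ := isOpen_Ioi.exists_is_const_of_deriv_eq_zero isPreconnected_Ioi
    (fun r hr => (hd r hr).differentiableAt.differentiableWithinAt) (fun r hr => (hd r hr).deriv)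
  refine ⟨K, fun r hr => ?_⟩
  rw [← hK r hr, mul_assoc, ← Complex.exp_add, add_neg_cancel, Complex.exp_zero, mul_one]

lemma not_integrableOn_Ioi_of_tendsto_atTop {f : ℝ → ℝ} {a : ℝ}
    (hf : Filter.Tendsto f Filter.atTop Filter.atTop) : ¬ IntegrableOn f (Ioi a) := by
  intro h
  obtain ⟨R, hR⟩ := Filter.eventually_atTop.1 (hf.eventually_ge_atTop 1)
  have h1 : IntegrableOn (fun _ : ℝ => (1 : ℝ)) (Ioi (max a R)) := by
    refine Integrable.mono (h.mono_set (Ioi_subset_Ioi (le_max_left a R)))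
      aestronglyMeasurable_const ?_
    filter_upwards [ae_restrict_mem measurableSet_Ioi] with r hr
    have := hR r ((le_max_right a R).trans (le_of_lt hr))
    rw [norm_one]
    exact this.trans (le_abs_self _)
  simp [integrableOn_const_iff] at h1

/-- An exponential combination with a growing term is not square integrable. -/
lemma eq_zero_of_integrableOn_sq_norm {w K L : ℂ} (hw : w.re < 0)
    (h : IntegrableOn (fun r : ℝ => ‖L * Complex.exp (w * r) - K * Complex.exp (-(w * r))‖ ^ 2)
      (Ioi 0)) : K = 0 := by
  by_contra hK
  refine not_integrableOn_Ioi_of_tendsto_atTop ?_ h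
  refine (Filter.tendsto_pow_atTop two_ne_zero).comp ?_
  have hlin : Filter.Tendsto (fun r : ℝ => -w.re * r) Filter.atTop Filter.atTop :=
    Filter.tendsto_id.const_mul_atTop (neg_pos.2 hw)
  have hlow : Filter.Tendsto (fun r : ℝ => ‖K‖ * Real.exp (-w.re * r) + -‖L‖)
      Filter.atTop Filter.atTop :=
    Filter.tendsto_atTop_add_const_right _ _
      ((Real.tendsto_exp_atTop.comp hlin).const_mul_atTop (norm_pos_iff.2 hK))
  refine Filter.tendsto_atTop_mono' _ ?_ hlow
  filter_upwards [Filter.eventually_ge_atTop 0] with r hr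
  have h1 := norm_sub_norm_le (K * Complex.exp (-(w * r))) (L * Complex.exp (w * r))
  rw [norm_sub_rev, norm_mul, norm_mul, Complex.norm_exp, Complex.norm_exp] at h1
  have e1 : (w * r).re = w.re * r := by simp
  rw [Complex.neg_re, e1, ← neg_mul] at h1
  have h2 : Real.exp (w.re * r) ≤ 1 :=
    Real.exp_le_one_iff.2 (mul_nonpos_of_nonpos_of_nonneg hw.le hr)
  have h3 := mul_le_mul_of_nonneg_left h2 (norm_nonneg L)
  linarith

/-- If `g : (0,∞) → ℂ` is twice differentiable, satisfies `g'' = i ρ² g` on `(0,∞)`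
and is square integrable, then `g` is a constant multiple of
`r ↦ exp(e^{-i3π/4} ρ r)`; in particular the space of such solutions is
one-dimensional. -/
theorem stmt2 (ρ : ℝ) (hρ : 0 < ρ) (g : ℝ → ℂ)
    (hg1 : ∀ r ∈ Ioi (0 : ℝ), DifferentiableAt ℝ g r)
    (hg2 : ∀ r ∈ Ioi (0 : ℝ), DifferentiableAt ℝ (deriv g) r)
    (heq : ∀ r ∈ Ioi (0 : ℝ), deriv (deriv g) r = Complex.I * (ρ : ℂ) ^ 2 * g r)
    (hL2 : IntegrableOn (fun r => ‖g r‖ ^ 2) (Ioi 0)) :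
    ∃ c : ℂ, ∀ r ∈ Ioi (0 : ℝ),
      g r = c * Complex.exp (Complex.exp (-Complex.I * (3 * Real.pi / 4)) * ρ * r) := by
  set w : ℂ := Complex.exp (-Complex.I * (3 * Real.pi / 4)) * ρ with hw
  have hsq : w ^ 2 = Complex.I * (ρ : ℂ) ^ 2 := by
    have e : ((2 : ℕ) : ℂ) * (-Complex.I * (3 * Real.pi / 4)) =
        Real.pi / 2 * Complex.I - 2 * Real.pi * Complex.I := by
      push_cast
      ring
    rw [hw, mul_pow, ← Complex.exp_nat_mul, e, Complex.exp_sub, Complex.exp_two_pi_mul_I,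
      Complex.exp_pi_div_two_mul_I, div_one]
  have hre : w.re < 0 := by
    have e : -Complex.I * (3 * Real.pi / 4) = ((-(3 * Real.pi / 4) : ℝ) : ℂ) * Complex.I := by
      push_cast
      ring
    rw [hw, Complex.re_mul_ofReal, e, Complex.exp_ofReal_mul_I_re, Real.cos_neg]
    refine mul_neg_of_neg_of_pos (Real.cos_neg_of_pi_div_two_lt_of_lt ?_ ?_) hρ <;>
      linarith [Real.pi_pos]
  have hw0 : w ≠ 0 := fun h => by simp [h] at hre
  have hd2 : ∀ r ∈ Ioi (0 : ℝ), HasDerivAt (deriv g) (w ^ 2 * g r) r := fun r hr => by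
    rw [hsq, ← heq r hr]
    exact (hg2 r hr).hasDerivAt
  have hd1 : ∀ r ∈ Ioi (0 : ℝ), HasDerivAt g (deriv g r) r := fun r hr => (hg1 r hr).hasDerivAt
  obtain ⟨K, hK⟩ := exists_mul_exp_eq_of_hasDerivAt (f := fun r => deriv g r - w * g r) (w := w)
    fun r hr => ((hd2 r hr).sub ((hd1 r hr).const_mul w)).congr_deriv (by ring)
  obtain ⟨L, hL⟩ := exists_mul_exp_eq_of_hasDerivAt (f := fun r => deriv g r + w * g r) (w := -w)
    fun r hr => ((hd2 r hr).add ((hd1 r hr).const_mul w)).congr_deriv (by ring)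
  simp only [neg_mul, neg_neg] at hL
  have hg : ∀ r ∈ Ioi (0 : ℝ),
      2 * w * g r = L * Complex.exp (w * r) - K * Complex.exp (-(w * r)) := fun r hr => by
    linear_combination hL r hr - hK r hr
  have hK0 : K = 0 := by
    refine eq_zero_of_integrableOn_sq_norm (L := L) hre ?_
    refine IntegrableOn.congr_fun (hL2.const_mul (‖2 * w‖ ^ 2)) (fun r hr => ?_) measurableSet_Ioi
    simp only [← hg r hr, norm_mul, mul_pow]
  refine ⟨L / (2 * w), fun r hr => ?_⟩
  have := hg r hr
  rw [hK0, zero_mul, sub_zero] at this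
  rw [div_mul_eq_mul_div, ← this]
  field_simp
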